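/- Let A ∈ ℂ^{m×n} be a nonzero matrix, q ≥ 2 a real number, r_1,…,r_m ∈ ℂ^n the conjugate transposes of the m rows of A, v ∈ ℂ^n a right singular vector corresponding to the largest singular value of A (i.e. v ≠ 0 and ‖Av‖_2 = ‖A‖_{2→2}‖v‖_2), and S = {v, r_1, …, r_m}. Then max_{x ∈ S, x ≠ 0} ‖Ax‖_q/‖x‖_2 ≥ [ (1/(2‖A‖_{2→∞})) · max_{x ∈ S, x ≠ 0} ‖Ax‖_q/‖x‖_2 ]^{(q−2)/(2(q−1))} · [ ‖Av‖_q/‖Av‖_2 ]^{1/(q−1)} · ‖A‖_{2→q}. -/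

import Mathlib

open scoped BigOperators

/-- The `ℓ_p` norm of a vector, for a real exponent `p`. -/
noncomputable def lpnorm {n : ℕ} {𝕜 : Type*} [RCLike 𝕜] (p : ℝ) (x : Fin n → 𝕜) : ℝ :=
  (∑ i, ‖x i‖ ^ p) ^ (1 / p)

/-- The `ℓ_∞` norm of a vector. -/
noncomputable def linorm {n : ℕ} {𝕜 : Type*} [RCLike 𝕜] (x : Fin n → 𝕜) : ℝ :=
  ⨆ i, ‖x i‖

/-- The `p → q` operator norm of a matrix: `max_{x ≠ 0} ‖Ax‖_q / ‖x‖_p`. -/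
noncomputable def opNorm {m n : ℕ} {𝕜 : Type*} [RCLike 𝕜] (p q : ℝ)
    (A : Matrix (Fin m) (Fin n) 𝕜) : ℝ :=
  ⨆ x : {x : Fin n → 𝕜 // x ≠ 0}, lpnorm q (A.mulVec x.1) / lpnorm p x.1

/-- The `p → ∞` operator norm of a matrix: `max_{x ≠ 0} ‖Ax‖_∞ / ‖x‖_p`. -/
noncomputable def opNormInf {m n : ℕ} {𝕜 : Type*} [RCLike 𝕜] (p : ℝ)
    (A : Matrix (Fin m) (Fin n) 𝕜) : ℝ :=
  ⨆ x : {x : Fin n → 𝕜 // x ≠ 0}, linorm (A.mulVec x.1) / lpnorm p x.1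

/-- `row A i` is the conjugate transpose of the `i`-th row of `A`,
so that `(A x) i = ⟨x, row A i⟩` for the standard Hermitian inner product. -/
def row {m n : ℕ} {𝕜 : Type*} [RCLike 𝕜] (A : Matrix (Fin m) (Fin n) 𝕜) (i : Fin m) :
    Fin n → 𝕜 := fun k => star (A i k)

/-- The standard Hermitian inner product `⟨x, y⟩ = ∑ k, x k * conj (y k)`. -/
noncomputable def hinner {n : ℕ} (x y : Fin n → ℂ) : ℂ := ∑ k, x k * star (y k)

open scoped Matrix

lemma lpnorm_nonneg {n : ℕ} {𝕜 : Type*} [RCLike 𝕜] (p : ℝ) (x : Fin n → 𝕜) :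
    0 ≤ lpnorm p x := by
  unfold lpnorm; positivity

lemma lpnorm_rpow_self {n : ℕ} {𝕜 : Type*} [RCLike 𝕜] {p : ℝ} (hp : p ≠ 0) (x : Fin n → 𝕜) :
    lpnorm p x ^ p = ∑ i, ‖x i‖ ^ p := by
  rw [lpnorm, ← Real.rpow_mul (by positivity), one_div_mul_cancel hp, Real.rpow_one]

lemma lpnorm_two_eq_norm {n : ℕ} {𝕜 : Type*} [RCLike 𝕜] (x : Fin n → 𝕜) :
    lpnorm 2 x = ‖WithLp.toLp 2 x‖ := by
  simp [lpnorm, EuclideanSpace.norm_eq, Real.sqrt_eq_rpow]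

lemma lpnorm_two_pos {n : ℕ} {𝕜 : Type*} [RCLike 𝕜] {x : Fin n → 𝕜} (hx : x ≠ 0) :
    0 < lpnorm 2 x := by
  rw [lpnorm_two_eq_norm, norm_pos_iff]
  simpa using hx

lemma norm_apply_le_lpnorm_two {n : ℕ} {𝕜 : Type*} [RCLike 𝕜] (x : Fin n → 𝕜) (i : Fin n) :
    ‖x i‖ ≤ lpnorm 2 x := by
  rw [lpnorm_two_eq_norm]
  exact PiLp.norm_apply_le (WithLp.toLp 2 x) i

lemma norm_star_dotProduct_le_lpnorm_two {n : ℕ} (x y : Fin n → ℂ) :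
    ‖star x ⬝ᵥ y‖ ≤ lpnorm 2 x * lpnorm 2 y := by
  have h := norm_inner_le_norm (𝕜 := ℂ) (WithLp.toLp 2 x) (WithLp.toLp 2 y)
  rwa [EuclideanSpace.inner_toLp_toLp, dotProduct_comm, ← lpnorm_two_eq_norm,
    ← lpnorm_two_eq_norm] at h

lemma star_dotProduct_self_eq_lpnorm_two_sq {n : ℕ} (x : Fin n → ℂ) :
    star x ⬝ᵥ x = ((lpnorm 2 x ^ 2 : ℝ) : ℂ) := by
  have h := inner_self_eq_norm_sq_to_K (𝕜 := ℂ) (WithLp.toLp 2 x)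
  rw [EuclideanSpace.inner_toLp_toLp, dotProduct_comm, ← lpnorm_two_eq_norm] at h
  simpa using h

lemma exists_lpnorm_two_mulVec_le {m n : ℕ} (A : Matrix (Fin m) (Fin n) ℂ) :
    ∃ C, ∀ x, lpnorm 2 (A *ᵥ x) ≤ C * lpnorm 2 x := by
  refine ⟨‖LinearMap.toContinuousLinearMap (Matrix.toEuclideanLin A)‖, fun x => ?_⟩
  have h := (LinearMap.toContinuousLinearMap (Matrix.toEuclideanLin A)).le_opNorm
    (WithLp.toLp 2 x)
  rw [lpnorm_two_eq_norm, lpnorm_two_eq_norm]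
  simpa using h

lemma lpnorm_two_mulVec_le_opNorm {m n : ℕ} (A : Matrix (Fin m) (Fin n) ℂ) (x : Fin n → ℂ) :
    lpnorm 2 (A *ᵥ x) ≤ opNorm 2 2 A * lpnorm 2 x := by
  obtain ⟨C, hC⟩ := exists_lpnorm_two_mulVec_le A
  rcases eq_or_ne x 0 with rfl | hx
  · simp [lpnorm]
  · rw [← div_le_iff₀ (lpnorm_two_pos hx)]
    refine le_ciSup (f := fun x : {x : Fin n → ℂ // x ≠ 0} =>
      lpnorm 2 (A.mulVec x.1) / lpnorm 2 x.1) ⟨C, ?_⟩ ⟨x, hx⟩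
    rintro _ ⟨y, rfl⟩
    exact (div_le_iff₀ (lpnorm_two_pos y.2)).2 (hC y.1)

lemma linorm_le_opNormInf_mul {m n : ℕ} (A : Matrix (Fin m) (Fin n) ℂ) {x : Fin n → ℂ}
    (hx : x ≠ 0) : linorm (A *ᵥ x) ≤ opNormInf 2 A * lpnorm 2 x := by
  obtain ⟨C, hC⟩ := exists_lpnorm_two_mulVec_le A
  rw [← div_le_iff₀ (lpnorm_two_pos hx)]
  refine le_ciSup (f := fun x : {x : Fin n → ℂ // x ≠ 0} =>
    linorm (A.mulVec x.1) / lpnorm 2 x.1) ⟨C, ?_⟩ ⟨x, hx⟩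
  rintro _ ⟨y, rfl⟩
  refine (div_le_iff₀ (lpnorm_two_pos y.2)).2 (le_trans ?_ (hC y.1))
  exact Real.iSup_le (fun i => norm_apply_le_lpnorm_two _ i) (lpnorm_nonneg _ _)

lemma mulVec_apply_eq_star_row {m n : ℕ} (A : Matrix (Fin m) (Fin n) ℂ) (x : Fin n → ℂ)
    (i : Fin m) : (A *ᵥ x) i = star (row A i) ⬝ᵥ x := by
  simp [Matrix.mulVec, dotProduct, row]

lemma lpnorm_two_row_sq_le {m n : ℕ} (A : Matrix (Fin m) (Fin n) ℂ) (i : Fin m) :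
    lpnorm 2 (row A i) ^ 2 ≤ ‖(A *ᵥ row A i) i‖ := by
  rw [mulVec_apply_eq_star_row, star_dotProduct_self_eq_lpnorm_two_sq, Complex.norm_real]
  exact le_abs_self _

lemma lpnorm_two_row_le_opNormInf {m n : ℕ} (A : Matrix (Fin m) (Fin n) ℂ) {i : Fin m}
    (hi : row A i ≠ 0) : lpnorm 2 (row A i) ≤ opNormInf 2 A := by
  have h₁ : ‖(A *ᵥ row A i) i‖ ≤ linorm (A *ᵥ row A i) :=
    le_ciSup (f := fun j => ‖(A *ᵥ row A i) j‖) (Set.finite_range _).bddAbove i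
  have h₂ := linorm_le_opNormInf_mul A hi
  have h₃ := lpnorm_two_row_sq_le A i
  have h₄ := lpnorm_two_pos hi
  nlinarith

/-- Hölder's inequality against a vector whose entries have moduli `‖y i‖ ^ (q - 1)`. -/
lemma norm_star_dotProduct_le {m : ℕ} {q : ℝ} (hq : 1 < q) {y z : Fin m → ℂ}
    (hz : ∀ i, ‖z i‖ = ‖y i‖ ^ (q - 1)) (u : Fin m → ℂ) :
    ‖star z ⬝ᵥ u‖ ≤ lpnorm q y ^ (q - 1) * lpnorm q u := by
  have hq0 : q ≠ 0 := by positivity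
  have hq1 : q - 1 ≠ 0 := (sub_pos.2 hq).ne'
  have hc : (q / (q - 1)).HolderConjugate q :=
    (Real.HolderConjugate.conjExponent hq).symm
  have h := Real.inner_le_Lp_mul_Lq_of_nonneg Finset.univ (f := fun i => ‖z i‖)
    (g := fun i => ‖u i‖) hc (fun _ _ => norm_nonneg _) (fun _ _ => norm_nonneg _)
  have e : (∑ i, ‖z i‖ ^ (q / (q - 1))) ^ (1 / (q / (q - 1))) = lpnorm q y ^ (q - 1) := by
    have : ∀ i, ‖z i‖ ^ (q / (q - 1)) = ‖y i‖ ^ q := fun i => by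
      rw [hz, ← Real.rpow_mul (norm_nonneg _)]
      congr 1; field_simp
    simp_rw [this]
    rw [lpnorm, ← Real.rpow_mul (by positivity)]
    congr 1; field_simp
  rw [e] at h
  refine le_trans (norm_sum_le _ _) (le_trans (le_of_eq ?_) h)
  simp

lemma lpnorm_rpow_le_of_norm_le {m : ℕ} {q K : ℝ} (hq : 2 ≤ q) {u : Fin m → ℂ}
    (hK : ∀ i, ‖u i‖ ≤ K) : lpnorm q u ^ q ≤ lpnorm 2 u ^ 2 * K ^ (q - 2) := by
  rw [← Real.rpow_two, lpnorm_rpow_self (by positivity), lpnorm_rpow_self two_ne_zero,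
    Finset.sum_mul]
  refine Finset.sum_le_sum fun i _ => ?_
  calc ‖u i‖ ^ q = ‖u i‖ ^ (2 + (q - 2)) := by congr 1; ring
    _ = ‖u i‖ ^ (2 : ℝ) * ‖u i‖ ^ (q - 2) :=
      Real.rpow_add_of_nonneg (norm_nonneg _) zero_le_two (by linarith)
    _ ≤ _ := by
      gcongr
      exact hK i

/-- A bound for `‖A‖_{2→q}` that interpolates between `‖A‖_{2→2}` and the sizes of the
columns of `A * Aᴴ` in `ℓ_q`. -/
lemma lpnorm_mulVec_div_rpow_le {m n : ℕ} {q σ K : ℝ} (hq : 2 ≤ q)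
    (A : Matrix (Fin m) (Fin n) ℂ) (hK0 : 0 ≤ K)
    (hσ : ∀ x, lpnorm 2 (A *ᵥ x) ≤ σ * lpnorm 2 x)
    (hK : ∀ i, lpnorm q (A *ᵥ row A i) ≤ K) {x : Fin n → ℂ} (hx : x ≠ 0) :
    (lpnorm q (A *ᵥ x) / lpnorm 2 x) ^ (2 * (q - 1)) ≤ σ ^ 2 * K ^ (q - 2) := by
  have hb := lpnorm_two_pos hx
  set a := lpnorm q (A *ᵥ x) with ha_def
  set b := lpnorm 2 x
  rcases (lpnorm_nonneg q (A *ᵥ x)).eq_or_lt with ha | ha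
  · rw [ha_def, ← ha, zero_div, Real.zero_rpow (by linarith)]
    positivity
  set z : Fin m → ℂ := fun i => ((‖(A *ᵥ x) i‖ ^ (q - 2) : ℝ) : ℂ) * (A *ᵥ x) i with z_def
  have hz : ∀ i, ‖z i‖ = ‖(A *ᵥ x) i‖ ^ (q - 1) := fun i => by
    rw [z_def, norm_mul, Complex.norm_real, Real.norm_of_nonneg (by positivity)]
    nth_rw 2 [← Real.rpow_one ‖(A *ᵥ x) i‖]
    rw [← Real.rpow_add_of_nonneg (norm_nonneg _) (by linarith) zero_le_one]
    congr 1; ring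
  have hadj : ∀ u, star (Aᴴ *ᵥ z) ⬝ᵥ u = star z ⬝ᵥ A *ᵥ u := fun u => by
    rw [Matrix.star_mulVec, Matrix.conjTranspose_conjTranspose, Matrix.dotProduct_mulVec]
  have hzy : star z ⬝ᵥ A *ᵥ x = ((a ^ q : ℝ) : ℂ) := by
    rw [ha_def, lpnorm_rpow_self (by positivity), Complex.ofReal_sum, dotProduct]
    refine Finset.sum_congr rfl fun i _ => ?_
    have : ‖(A *ᵥ x) i‖ ^ q = ‖(A *ᵥ x) i‖ ^ (q - 2) * ‖(A *ᵥ x) i‖ ^ 2 := by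
      rw [← Real.rpow_two, ← Real.rpow_add_of_nonneg (norm_nonneg _) (by linarith) zero_le_two]
      congr 1; ring
    rw [this, Pi.star_apply, z_def, star_mul', mul_assoc, Complex.ofReal_mul]
    congr 1
    · exact Complex.conj_ofReal _
    · simpa using Complex.conj_mul' ((A *ᵥ x) i)
  set w := Aᴴ *ᵥ z
  have hW0 : a ^ q ≤ lpnorm 2 w * b := by
    have h := norm_star_dotProduct_le_lpnorm_two w x
    rw [hadj, hzy, Complex.norm_real] at h
    exact (le_abs_self _).trans h
  have hB : lpnorm 2 w ^ 2 ≤ a ^ (q - 1) * lpnorm q (A *ᵥ w) := by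
    have h := norm_star_dotProduct_le (by linarith) hz (A *ᵥ w)
    rw [← hadj, star_dotProduct_self_eq_lpnorm_two_sq, Complex.norm_real] at h
    exact (le_abs_self _).trans h
  have hsup : ∀ i, ‖(A *ᵥ w) i‖ ≤ a ^ (q - 1) * K := fun i => by
    have h := norm_star_dotProduct_le (by linarith) hz (A *ᵥ row A i)
    rw [← hadj, Matrix.star_dotProduct, norm_star, ← mulVec_apply_eq_star_row] at h
    exact h.trans (mul_le_mul_of_nonneg_left (hK i) (by positivity))
  have hint := lpnorm_rpow_le_of_norm_le hq hsup
  set c := a ^ (q - 1) with c_def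
  have hc : 0 < c := by positivity
  have hac : a ^ q = c * a := by
    rw [c_def, ← Real.rpow_add_one ha.ne']; congr 1; ring
  have hW : 0 < lpnorm 2 w := by
    by_contra! h
    have : 0 < a ^ q := by positivity
    nlinarith
  set W := lpnorm 2 w
  set B := lpnorm q (A *ᵥ w)
  have hle : a / b ≤ W / c := by
    rw [div_le_div_iff₀ hb hc]; linarith
  have hWB : W * (W / c) ≤ B := by
    rw [← mul_div_assoc, div_le_iff₀ hc]; linarith
  have hup : (W * (W / c)) ^ q ≤ W ^ 2 * c ^ (q - 2) * (σ ^ 2 * K ^ (q - 2)) := by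
    calc (W * (W / c)) ^ q ≤ B ^ q := by gcongr
      _ ≤ _ := hint
      _ ≤ (σ * W) ^ 2 * (c * K) ^ (q - 2) := by
        gcongr
        · exact lpnorm_nonneg _ _
        · exact hσ w
      _ = _ := by rw [Real.mul_rpow hc.le hK0]; ring
  have heq : (W * (W / c)) ^ q = W ^ 2 * c ^ (q - 2) * (W / c) ^ (2 * (q - 1)) := by
    rw [Real.mul_rpow hW.le (by positivity), Real.div_rpow hW.le hc.le,
      Real.div_rpow hW.le hc.le, ← Real.rpow_two]
    rw [mul_div_assoc', mul_div_assoc', div_eq_div_iff (by positivity) (by positivity),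
      ← Real.rpow_add hW]
    have e₁ : c ^ (2 * (q - 1)) = c ^ (q - 2) * c ^ q := by
      rw [← Real.rpow_add hc]; congr 1; ring
    have e₂ : W ^ (q + q) = W ^ (2 : ℝ) * W ^ (2 * (q - 1)) := by
      rw [← Real.rpow_add hW]; congr 1; ring
    rw [e₁, e₂]; ring
  rw [heq] at hup
  exact (Real.rpow_le_rpow (by positivity) hle (by linarith)).trans
    (le_of_mul_le_mul_left hup (by positivity))

theorem stmt0 {m n : ℕ} (q : ℝ) (hq : 2 ≤ q) (A : Matrix (Fin m) (Fin n) ℂ) (hA : A ≠ 0)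
    (v : Fin n → ℂ) (hv : v ≠ 0)
    (hsv : lpnorm 2 (A.mulVec v) = opNorm 2 2 A * lpnorm 2 v)
    (M : ℝ)
    (hM : M = sSup {t : ℝ | ∃ x ∈ insert v (Set.range (row A)), x ≠ 0 ∧
      t = lpnorm q (A.mulVec x) / lpnorm 2 x}) :
    M ≥ (1 / (2 * opNormInf 2 A) * M) ^ ((q - 2) / (2 * (q - 1))) *
      (lpnorm q (A.mulVec v) / lpnorm 2 (A.mulVec v)) ^ (1 / (q - 1)) * opNorm 2 q A := by
  obtain ⟨i, hi⟩ : ∃ i, row A i ≠ 0 := by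
    by_contra! h
    refine hA (Matrix.ext fun i k => ?_)
    simpa [row] using congrFun (h i) k
  have hri := lpnorm_two_pos hi
  have hL : 0 < opNormInf 2 A := hri.trans_le (lpnorm_two_row_le_opNormInf A hi)
  have hσ : 0 < opNorm 2 2 A := by
    have h₁ := norm_apply_le_lpnorm_two (A *ᵥ row A i) i
    have h₂ := lpnorm_two_row_sq_le A i
    have h₃ := lpnorm_two_mulVec_le_opNorm A (row A i)
    by_contra! h
    nlinarith
  have hv' := lpnorm_two_pos hv
  set L := opNormInf 2 A
  set σ := opNorm 2 2 A
  have hle : ∀ x ∈ insert v (Set.range (row A)), x ≠ 0 →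
      lpnorm q (A *ᵥ x) / lpnorm 2 x ≤ M := by
    intro x hxS hx
    rw [hM]
    refine le_csSup (Set.Finite.bddAbove ?_) ⟨x, hxS, hx, rfl⟩
    refine Set.Finite.subset ((((Set.finite_range (row A)).insert v)).image
      fun x => lpnorm q (A *ᵥ x) / lpnorm 2 x) ?_
    rintro _ ⟨y, hy, -, rfl⟩
    exact ⟨y, hy, rfl⟩
  have hMv := hle v (Set.mem_insert _ _) hv
  have hM0 : 0 ≤ M :=
    (div_nonneg (lpnorm_nonneg q (A *ᵥ v)) hv'.le).trans hMv
  have hrow : ∀ j, lpnorm q (A *ᵥ row A j) ≤ M * L := by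
    intro j
    rcases eq_or_ne (row A j) 0 with h | h
    · rw [h, Matrix.mulVec_zero]
      have hq0 : q ≠ 0 := by positivity
      simp only [lpnorm, Pi.zero_apply, norm_zero, Real.zero_rpow hq0, Finset.sum_const_zero]
      rw [Real.zero_rpow (one_div_ne_zero hq0)]
      positivity
    · calc lpnorm q (A *ᵥ row A j) ≤ M * lpnorm 2 (row A j) :=
            (div_le_iff₀ (lpnorm_two_pos h)).1 (hle _ (Set.mem_insert_of_mem _ ⟨j, rfl⟩) h)
        _ ≤ M * L := by
            gcongr
            exact lpnorm_two_row_le_opNormInf A h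
  have hq1 : 0 < q - 1 := by linarith
  set α := (q - 2) / (2 * (q - 1)) with hα
  set β := 1 / (q - 1) with hβ
  have hα0 : 0 ≤ α := div_nonneg (by linarith) (by linarith)
  have hβ0 : 0 ≤ β := by positivity
  have hN : opNorm 2 q A ≤ σ ^ β * (M * L) ^ α := by
    refine Real.iSup_le (fun x => ?_) (by positivity)
    have h := lpnorm_mulVec_div_rpow_le hq A (mul_nonneg hM0 hL.le)
      (lpnorm_two_mulVec_le_opNorm A) hrow x.2
    have h0 : 0 ≤ lpnorm q (A *ᵥ x.1) / lpnorm 2 x.1 :=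
      div_nonneg (lpnorm_nonneg _ _) (lpnorm_nonneg _ _)
    rw [← Real.rpow_le_rpow_iff h0 (by positivity) (by positivity : 0 < 2 * (q - 1))]
    refine h.trans_eq ?_
    rw [Real.mul_rpow (x := σ ^ β) (by positivity) (by positivity), ← Real.rpow_mul hσ.le,
      ← Real.rpow_mul (by positivity), ← Real.rpow_two]
    congr 2
    · rw [hβ]; field_simp
    · rw [hα]; field_simp
  have hR : lpnorm q (A *ᵥ v) / lpnorm 2 (A *ᵥ v) ≤ M / σ := by
    rw [hsv, mul_comm σ, ← div_div]
    gcongr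
  have hαβ : α + β + α = 1 := by rw [hα, hβ]; field_simp; ring
  have hcancel : (1 / (2 * L)) ^ α * L ^ α ≤ 1 := by
    rw [← Real.mul_rpow (by positivity) hL.le]
    refine Real.rpow_le_one (by positivity) ?_ hα0
    rw [one_div_mul_eq_div, div_le_one (by positivity)]
    linarith
  have hMpow : M ^ α * M ^ β * M ^ α = M := by
    rw [← Real.rpow_add_of_nonneg hM0 hα0 hβ0,
      ← Real.rpow_add_of_nonneg hM0 (by positivity) hα0, hαβ, Real.rpow_one]
  calc (1 / (2 * L) * M) ^ α * (lpnorm q (A *ᵥ v) / lpnorm 2 (A *ᵥ v)) ^ β * opNorm 2 q A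
      ≤ (1 / (2 * L) * M) ^ α * (M / σ) ^ β * (σ ^ β * (M * L) ^ α) := by
        have := div_nonneg (lpnorm_nonneg q (A *ᵥ v)) (lpnorm_nonneg 2 (A *ᵥ v))
        have : 0 ≤ opNorm 2 q A :=
          Real.iSup_nonneg fun _ => div_nonneg (lpnorm_nonneg _ _) (lpnorm_nonneg _ _)
        gcongr
    _ = ((1 / (2 * L)) ^ α * L ^ α) * (M ^ α * M ^ β * M ^ α) := by
        rw [Real.mul_rpow (by positivity) hM0, Real.mul_rpow hM0 hL.le,
          Real.div_rpow hM0 hσ.le]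
        have := (Real.rpow_pos_of_pos hσ β).ne'
        field_simp
    _ ≤ M := by
        rw [hMpow]
        exact mul_le_of_le_one_left hM0 hcancel
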